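/- arXiv:2502.01539 — 2 statements merged into one kernel-verified Lean document; each statement's English description precedes it below -/
import Mathlib

section
/- Both natural projections P(L) ← F → P(Φ) from the variety of flexes F of plane cubics to the two factors are surjective. -/
noncomputable section

open MvPolynomial

/-- The ten exponent vectors `(i₀,i₁,i₂)` with `i₀+i₁+i₂ = 3`. -/
def cubicExp : Fin 10 → Fin 3 → ℕ :=
  ![![3,0,0], ![0,3,0], ![0,0,3], ![2,1,0], ![2,0,1],
    ![1,2,0], ![0,2,1], ![1,0,2], ![0,1,2], ![1,1,1]]

variable (k : Type) [Field k]

/-- `f = Σ_{i₀+i₁+i₂=3} α_{i₀i₁i₂} x₀^{i₀} x₁^{i₁} x₂^{i₂}`, the generic ternary cubic. -/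
def fpoly : MvPolynomial (Fin 3 ⊕ Fin 10) k :=
  ∑ j : Fin 10, X (Sum.inr j) * ∏ i : Fin 3, X (Sum.inl i) ^ cubicExp j i

/-- `h = det(∂²f/∂xᵢ∂xⱼ)`, the Hessian determinant of `f` in the `x`-variables. -/
def hpoly : MvPolynomial (Fin 3 ⊕ Fin 10) k :=
  Matrix.det (Matrix.of fun i j : Fin 3 =>
    pderiv (Sum.inl i) (pderiv (Sum.inl j) (fpoly k)))

/-- The variety of flexes `F ⊆ ℙ(L) × ℙ(Φ)`. -/
def Flex : Set (Projectivization k (Fin 3 → k) × Projectivization k (Fin 10 → k)) :=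
  {PQ | ∀ (v : Fin 3 → k) (w : Fin 10 → k) (hv : v ≠ 0) (hw : w ≠ 0),
    Projectivization.mk k v hv = PQ.1 → Projectivization.mk k w hw = PQ.2 →
    eval (Sum.elim v w) (fpoly k) = 0 ∧ eval (Sum.elim v w) (hpoly k) = 0}

/-- The substitution setting the first `j` of `n` variables to zero. -/
def killVars (n : ℕ) (R : Type*) [CommRing R] (j : ℕ) :
    MvPolynomial (Fin n) R →ₐ[R] MvPolynomial (Fin n) R :=
  aeval fun i => if (i : ℕ) < j then 0 else X i

theorem killVars_succ_comp (n : ℕ) (R : Type*) [CommRing R] (j : ℕ) :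
    (killVars n R (j + 1)).comp (killVars n R j) = killVars n R (j + 1) := by
  ext1 i
  rcases lt_or_ge (i : ℕ) j with h | h
  · simp [killVars, h, h.le]
  · simp [killVars, h.not_gt]

/-- Over a domain, the kernel of the substitution killing the first `j` variables
has height at least `j`. -/
theorem le_height_ker_killVars {n : ℕ} (R : Type*) [CommRing R] [IsDomain R] {j : ℕ}
    (hj : j ≤ n) : (j : ℕ∞) ≤ (RingHom.ker (killVars n R j)).height := by
  induction j with
  | zero => simp
  | succ j ih =>
    have hprime (m : ℕ) : (RingHom.ker (killVars n R m)).IsPrime := RingHom.ker_isPrime _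
    have hlt : RingHom.ker (killVars n R j) < RingHom.ker (killVars n R (j + 1)) := by
      refine lt_of_le_of_ne (fun p hp => ?_) fun heq => ?_
      · rw [RingHom.mem_ker] at hp ⊢
        rw [← killVars_succ_comp, AlgHom.comp_apply, hp, map_zero]
      · have hX : (X ⟨j, hj⟩ : MvPolynomial (Fin n) R) ∈ RingHom.ker (killVars n R (j + 1)) := by
          simp [RingHom.mem_ker, killVars]
        rw [← heq] at hX
        simp [RingHom.mem_ker, killVars] at hX
    refine le_trans ?_ (Ideal.height_add_one_le_of_lt_of_isPrime hlt)
    push_cast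
    gcongr
    exact ih (by omega)

/-- The ideal of the origin in affine `n`-space has height at least `n`. -/
theorem le_height_vanishingIdeal_zero (n : ℕ) (K : Type*) [Field K] :
    (n : ℕ∞) ≤ (vanishingIdeal K {(0 : Fin n → K)}).height := by
  refine (le_height_ker_killVars K le_rfl).trans (Ideal.height_mono fun p hp => ?_)
  rw [mem_vanishingIdeal_singleton_iff]
  have hcomp : (aeval (0 : Fin n → K)).comp (killVars n K n) = aeval (0 : Fin n → K) := by
    ext1 i
    simp [killVars]
  rw [← hcomp, AlgHom.comp_apply, RingHom.mem_ker.mp hp, map_zero]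

/-- Fewer than `n` polynomials in `n` variables over an algebraically closed field that vanish
at the origin have another common zero. -/
theorem exists_ne_zero_eval_eq_zero {n : ℕ} {K : Type*} [Field K] [IsAlgClosed K]
    (s : Finset (MvPolynomial (Fin n) K)) (hs : s.card < n)
    (h0 : ∀ p ∈ s, eval 0 p = 0) :
    ∃ v : Fin n → K, v ≠ 0 ∧ ∀ p ∈ s, eval v p = 0 := by
  by_contra! hne
  have hlocus : zeroLocus K (Ideal.span (s : Set (MvPolynomial (Fin n) K))) = {0} := by
    rw [zeroLocus_span]
    ext v
    simp only [aeval_eq_eval, Finset.mem_coe, Set.mem_ofPred_eq, Set.mem_singleton_iff]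
    refine ⟨fun hv => ?_, fun hv => hv ▸ h0⟩
    by_contra hv0
    obtain ⟨p, hp, hpv⟩ := hne v hv0
    exact hpv (hv p hp)
  have hrad := vanishingIdeal_zeroLocus_eq_radical (k := K) (K := K)
    (Ideal.span (s : Set (MvPolynomial (Fin n) K)))
  rw [hlocus] at hrad
  have hmin : vanishingIdeal K {(0 : Fin n → K)} ∈
      (Ideal.span (s : Set (MvPolynomial (Fin n) K))).minimalPrimes := by
    refine ⟨⟨inferInstance, hrad ▸ Ideal.le_radical⟩, fun J hJ _ => ?_⟩
    rw [hrad]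
    exact hJ.1.radical_le_iff.mpr hJ.2
  have := (le_height_vanishingIdeal_zero n K).trans
    (Ideal.height_le_card_of_mem_minimalPrimes_span_finset hmin)
  exact absurd (by exact_mod_cast this) hs.not_ge

theorem eval_fpoly (v : Fin 3 → k) (w : Fin 10 → k) :
    eval (Sum.elim v w) (fpoly k) =
      w 0 * v 0 ^ 3 + w 1 * v 1 ^ 3 + w 2 * v 2 ^ 3 + w 3 * v 0 ^ 2 * v 1 +
      w 4 * v 0 ^ 2 * v 2 + w 5 * v 0 * v 1 ^ 2 + w 6 * v 1 ^ 2 * v 2 + w 7 * v 0 * v 2 ^ 2 +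
      w 8 * v 1 * v 2 ^ 2 + w 9 * v 0 * v 1 * v 2 := by
  simp [fpoly, Fin.sum_univ_succ, Fin.prod_univ_succ, cubicExp]
  ring

theorem eval_hpoly (v : Fin 3 → k) (w : Fin 10 → k) :
    eval (Sum.elim v w) (hpoly k) =
      Matrix.det !![6 * w 0 * v 0 + 2 * w 3 * v 1 + 2 * w 4 * v 2,
          2 * w 3 * v 0 + 2 * w 5 * v 1 + w 9 * v 2,
          2 * w 4 * v 0 + w 9 * v 1 + 2 * w 7 * v 2;
        2 * w 3 * v 0 + 2 * w 5 * v 1 + w 9 * v 2,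
          2 * w 5 * v 0 + 6 * w 1 * v 1 + 2 * w 6 * v 2,
          w 9 * v 0 + 2 * w 6 * v 1 + 2 * w 8 * v 2;
        2 * w 4 * v 0 + w 9 * v 1 + 2 * w 7 * v 2,
          w 9 * v 0 + 2 * w 6 * v 1 + 2 * w 8 * v 2,
          2 * w 7 * v 0 + 2 * w 8 * v 1 + 6 * w 2 * v 2] := by
  rw [hpoly, RingHom.map_det]
  have pderiv_two (i : Fin 3 ⊕ Fin 10) : pderiv i (2 : MvPolynomial (Fin 3 ⊕ Fin 10) k) = 0 := by
    exact_mod_cast (pderiv i).map_natCast 2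
  have pderiv_three (i : Fin 3 ⊕ Fin 10) : pderiv i (3 : MvPolynomial (Fin 3 ⊕ Fin 10) k) = 0 := by
    exact_mod_cast (pderiv i).map_natCast 3
  congr 1
  ext i j
  fin_cases i <;> fin_cases j <;>
  · simp [fpoly, Fin.sum_univ_succ, Fin.prod_univ_succ, cubicExp, pderiv_X, Pi.single_apply, pderiv_two,
      pderiv_three]
    ring

/-- Membership in the variety of flexes can be tested on any representatives. -/
theorem mk_mem_Flex {v : Fin 3 → k} {w : Fin 10 → k} (hv : v ≠ 0) (hw : w ≠ 0)
    (hf : eval (Sum.elim v w) (fpoly k) = 0) (hh : eval (Sum.elim v w) (hpoly k) = 0) :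
    (Projectivization.mk k v hv, Projectivization.mk k w hw) ∈ Flex k := by
  intro v' w' hv' hw' hvv hww
  obtain ⟨a, rfl⟩ := (Projectivization.mk_eq_mk_iff' k _ _ _ _).mp hvv
  obtain ⟨b, rfl⟩ := (Projectivization.mk_eq_mk_iff' k _ _ _ _).mp hww
  rw [eval_fpoly] at hf ⊢
  rw [eval_hpoly, Matrix.det_fin_three] at hh ⊢
  simp only [Matrix.of_apply, Matrix.cons_val, Pi.smul_apply, smul_eq_mul] at hh ⊢
  constructor
  · linear_combination a ^ 3 * b * hf
  · linear_combination a ^ 3 * b ^ 3 * hh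

/-- Every point of the projective plane lies on a line. -/
theorem exists_linear_form_eq_zero (v : Fin 3 → k) :
    ∃ a b c : k, ¬ (a = 0 ∧ b = 0 ∧ c = 0) ∧ a * v 0 + b * v 1 + c * v 2 = 0 := by
  by_cases h : v 0 = 0
  · exact ⟨1, 0, 0, by simp, by simp [h]⟩
  · exact ⟨v 1, -v 0, 0, by simp [h], by ring⟩

/-- The coefficients of the triple line `(a x₀ + b x₁ + c x₂)³`. -/
def tripleLine (a b c : k) : Fin 10 → k :=
  ![a ^ 3, b ^ 3, c ^ 3, 3 * a ^ 2 * b, 3 * a ^ 2 * c, 3 * a * b ^ 2, 3 * b ^ 2 * c,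
    3 * a * c ^ 2, 3 * b * c ^ 2, 6 * a * b * c]

theorem exists_cubic_mem_Flex (P : Projectivization k (Fin 3 → k)) :
    ∃ Q, (P, Q) ∈ Flex k := by
  induction P with | h v hv
  obtain ⟨a, b, c, hne, hl⟩ := exists_linear_form_eq_zero k v
  have hw : tripleLine k a b c ≠ 0 := fun h =>
    hne ⟨by simpa [tripleLine] using congrFun h 0, by simpa [tripleLine] using congrFun h 1,
      by simpa [tripleLine] using congrFun h 2⟩
  refine ⟨_, mk_mem_Flex k hv hw ?_ ?_⟩
  · rw [eval_fpoly]
    simp only [tripleLine, Matrix.cons_val]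
    linear_combination (a * v 0 + b * v 1 + c * v 2) ^ 2 * hl
  · rw [eval_hpoly, Matrix.det_fin_three]
    simp only [tripleLine, Matrix.of_apply, Matrix.cons_val]
    ring

theorem exists_flex_mem_Flex [IsAlgClosed k] (Q : Projectivization k (Fin 10 → k)) :
    ∃ P, (P, Q) ∈ Flex k := by
  classical
  induction Q with | h w hw
  let φ : MvPolynomial (Fin 3 ⊕ Fin 10) k →ₐ[k] MvPolynomial (Fin 3) k :=
    aeval (Sum.elim X fun j => C (w j))
  have hφ (v : Fin 3 → k) (p) : eval v (φ p) = eval (Sum.elim v w) p := by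
    have : (aeval v).comp φ = aeval (R := k) (Sum.elim v w) := by
      ext i
      cases i <;> simp [φ]
    simpa using DFunLike.congr_fun this p
  obtain ⟨v, hv, h⟩ := exists_ne_zero_eval_eq_zero {φ (fpoly k), φ (hpoly k)}
    (Finset.card_le_two.trans_lt (by norm_num)) (by
      simp only [Finset.mem_insert, Finset.mem_singleton, forall_eq_or_imp, forall_eq, hφ]
      simp [eval_fpoly, eval_hpoly, Matrix.det_fin_three])
  simp only [Finset.mem_insert, Finset.mem_singleton, forall_eq_or_imp, forall_eq, hφ] at h
  exact ⟨_, mk_mem_Flex k hv hw h.1 h.2⟩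

/-- **Lemma.** Both natural projections `ℙ(L) ← F → ℙ(Φ)` from the variety of flexes
of plane cubics to the two factors are surjective. -/
theorem flex_projections_surjective [IsAlgClosed k] [CharZero k] :
    (∀ P : Projectivization k (Fin 3 → k), ∃ Q, (P, Q) ∈ Flex k) ∧
    (∀ Q : Projectivization k (Fin 10 → k), ∃ P, (P, Q) ∈ Flex k) := by
  exact ⟨exists_cubic_mem_Flex k, exists_flex_mem_Flex k⟩

end
end

section
/- The affine multi-cone C := {(v,w) ∈ L × Φ | f(v,w) = h(v,w) = 0} over the variety of flexes of plane cubics is an irreducible closed subset of the 13-dimensional affine space L × Φ. -/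
noncomputable section

open MvPolynomial

variable (k : Type) [Field k]

/-- The affine multi-cone `C ⊆ L × Φ = 𝔸¹³` over the variety of flexes:
the common zero set of `f` and `h`. -/
def flexCone : Set ((Fin 3 ⊕ Fin 10) → k) :=
  {x | eval x (fpoly k) = 0 ∧ eval x (hpoly k) = 0}

/-- The Zariski topology on affine space `σ → K` (closed sets are zero loci of polynomials). -/
instance zariskiTopology (σ K : Type*) [CommSemiring K] : TopologicalSpace (σ → K) :=
  TopologicalSpace.generateFrom {U | ∃ p : MvPolynomial σ K, U = {x | eval x p ≠ 0}}

section Zariski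

variable {σ τ K : Type*} [Field K]

lemma isTopologicalBasis_zariskiTopology :
    TopologicalSpace.IsTopologicalBasis
      {U : Set (σ → K) | ∃ p : MvPolynomial σ K, U = {x | eval x p ≠ 0}} where
  exists_subset_inter := by
    rintro _ ⟨p, rfl⟩ _ ⟨q, rfl⟩ x ⟨hp, hq⟩
    refine ⟨_, ⟨p * q, rfl⟩, by simpa using ⟨hp, hq⟩, fun y hy => ?_⟩
    simpa [not_or] using hy
  sUnion_eq := Set.eq_univ_of_forall fun x => ⟨_, ⟨1, rfl⟩, by simp⟩
  eq_generateFrom := rfl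

lemma isClosed_zeros (p : MvPolynomial σ K) : IsClosed {x : σ → K | eval x p = 0} := by
  rw [← isOpen_compl_iff]
  exact isTopologicalBasis_zariskiTopology.isOpen ⟨p, rfl⟩

lemma isIrreducible_affineSpace [Infinite K] : IsIrreducible (Set.univ : Set (σ → K)) := by
  refine ⟨Set.univ_nonempty, ?_⟩
  rintro U V hU hV ⟨x, -, hx⟩ ⟨y, -, hy⟩
  obtain ⟨_, ⟨p, rfl⟩, hxp, hpU⟩ :=
    isTopologicalBasis_zariskiTopology.exists_subset_of_mem_open hx hU
  obtain ⟨_, ⟨q, rfl⟩, hyq, hqV⟩ :=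
    isTopologicalBasis_zariskiTopology.exists_subset_of_mem_open hy hV
  have hp : p ≠ 0 := by rintro rfl; simp at hxp
  have hq : q ≠ 0 := by rintro rfl; simp at hyq
  by_contra hcon
  refine mul_ne_zero hp hq (MvPolynomial.funext fun z => ?_)
  rw [map_mul, map_zero]
  by_contra hz
  exact hcon ⟨z, trivial, hpU (left_ne_zero_of_mul hz), hqV (right_ne_zero_of_mul hz)⟩

/-- A function on affine space given by a polynomial. -/
def IsPolyFun (φ : (σ → K) → K) : Prop := ∃ p : MvPolynomial σ K, ∀ a, eval a p = φ a

namespace IsPolyFun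

variable {φ ψ : (σ → K) → K}

lemma const (c : K) : IsPolyFun fun _ : σ → K => c := ⟨C c, by simp⟩

lemma coord (i : σ) : IsPolyFun fun a : σ → K => a i := ⟨X i, by simp⟩

lemma add (hφ : IsPolyFun φ) (hψ : IsPolyFun ψ) : IsPolyFun fun a => φ a + ψ a := by
  obtain ⟨p, hp⟩ := hφ
  obtain ⟨q, hq⟩ := hψ
  exact ⟨p + q, by simp [hp, hq]⟩

lemma sub (hφ : IsPolyFun φ) (hψ : IsPolyFun ψ) : IsPolyFun fun a => φ a - ψ a := by
  obtain ⟨p, hp⟩ := hφ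
  obtain ⟨q, hq⟩ := hψ
  exact ⟨p - q, by simp [hp, hq]⟩

lemma neg (hφ : IsPolyFun φ) : IsPolyFun fun a => -φ a := by
  obtain ⟨p, hp⟩ := hφ
  exact ⟨-p, by simp [hp]⟩

lemma mul (hφ : IsPolyFun φ) (hψ : IsPolyFun ψ) : IsPolyFun fun a => φ a * ψ a := by
  obtain ⟨p, hp⟩ := hφ
  obtain ⟨q, hq⟩ := hψ
  exact ⟨p * q, by simp [hp, hq]⟩

end IsPolyFun

lemma continuous_of_isPolyFun {φ : (σ → K) → τ → K} (h : ∀ i, IsPolyFun fun a => φ a i) :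
    Continuous φ := by
  choose P hP using h
  refine continuous_generateFrom_iff.2 ?_
  rintro _ ⟨q, rfl⟩
  refine isTopologicalBasis_zariskiTopology.isOpen ⟨bind₁ P q, ?_⟩
  ext a
  have : eval a (bind₁ P q) = eval (φ a) q := by
    rw [eval, eval₂Hom_bind₁]
    exact congrArg (fun v => eval v q) (_root_.funext fun i => hP i a)
  simp [this]

end Zariski

section Height

variable {σ K : Type*} [Field K]

/-- The prime ideal generated by the variables in `s`. -/
def coordIdeal (K : Type*) [Field K] (s : Set σ) : Ideal (MvPolynomial σ K) :=
  RingHom.ker (aeval (R := K) (sᶜ.indicator (X : σ → MvPolynomial σ K)))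

instance (s : Set σ) : (coordIdeal K s).IsPrime := RingHom.ker_isPrime _

lemma X_mem_coordIdeal {s : Set σ} {i : σ} : X i ∈ coordIdeal K s ↔ i ∈ s := by
  by_cases h : i ∈ s <;> simp [coordIdeal, RingHom.mem_ker, h, X_ne_zero]

lemma coordIdeal_mono {s t : Set σ} (h : s ⊆ t) : coordIdeal K s ≤ coordIdeal K t := by
  intro p hp
  rw [coordIdeal, RingHom.mem_ker] at hp ⊢
  have key : aeval (R := K) (tᶜ.indicator (X : σ → MvPolynomial σ K)) =
      (aeval (R := K) (tᶜ.indicator X)).comp (aeval (R := K) (sᶜ.indicator X)) := by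
    ext1 i
    by_cases hs : i ∈ s
    · simp [hs, h hs]
    · simp [hs]
  rw [key, AlgHom.comp_apply, hp, map_zero]

lemma card_le_height_coordIdeal (s : Finset σ) :
    (s.card : ℕ∞) ≤ (coordIdeal K (s : Set σ)).height := by
  classical
  induction s using Finset.induction_on with
  | empty => simp
  | insert a s ha ih =>
    have hlt : coordIdeal K (s : Set σ) < coordIdeal K ((insert a s : Finset σ) : Set σ) := by
      refine lt_of_le_of_ne (coordIdeal_mono (by simp)) fun h => ha ?_
      have : (X a : MvPolynomial σ K) ∈ coordIdeal K ((insert a s : Finset σ) : Set σ) :=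
        X_mem_coordIdeal.2 (by simp)
      rw [← h] at this
      simpa using X_mem_coordIdeal.1 this
    rw [Finset.card_insert_of_notMem ha]
    rw [Nat.cast_add, Nat.cast_one]
    calc (s.card : ℕ∞) + 1 ≤ (coordIdeal K (s : Set σ)).height + 1 := by gcongr
      _ ≤ _ := Ideal.height_add_one_le_of_lt_of_isPrime hlt

lemma mem_coordIdeal_univ {p : MvPolynomial σ K} :
    p ∈ coordIdeal K (Set.univ : Set σ) ↔ eval 0 p = 0 := by
  have h : (Set.univᶜ.indicator X : σ → MvPolynomial σ K) = 0 := by simp; rfl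
  rw [coordIdeal, RingHom.mem_ker, h, aeval_zero, algebraMap_eq, C_eq_zero, ← eval_zero]

/-- Fewer polynomials without constant term than variables have a nontrivial common zero. -/
lemma exists_ne_zero_common_zero [Fintype σ] [IsAlgClosed K] (S : Set (MvPolynomial σ K))
    (hS : ∀ p ∈ S, eval 0 p = 0) (hcard : S.encard < Fintype.card σ) :
    ∃ v : σ → K, v ≠ 0 ∧ ∀ p ∈ S, eval v p = 0 := by
  by_contra! hcon
  have hz : zeroLocus K (Ideal.span S) = {0} := by
    rw [zeroLocus_span]
    ext v
    simp only [Set.mem_ofPred_eq, Set.mem_singleton_iff]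
    constructor
    · intro h
      by_contra hv
      obtain ⟨p, hp, hne⟩ := hcon v hv
      exact hne (by simpa [aeval_eq_eval] using h p hp)
    · rintro rfl p hp
      simpa [aeval_eq_eval] using hS p hp
  have hrad : (Ideal.span S).radical = coordIdeal K (Set.univ : Set σ) := by
    rw [← vanishingIdeal_zeroLocus_eq_radical (K := K), hz]
    ext p
    rw [mem_vanishingIdeal_singleton_iff, mem_coordIdeal_univ, aeval_eq_eval]
  have hmin : coordIdeal K (Set.univ : Set σ) ∈ (Ideal.span S).minimalPrimes := by
    rw [← Ideal.radical_minimalPrimes, hrad, Ideal.minimalPrimes_eq_subsingleton_self]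
    rfl
  have hfin : S.Finite := Set.finite_of_encard_le_coe hcard.le
  have h1 := Ideal.height_le_card_of_mem_minimalPrimes_span hfin hmin
  have h2 := card_le_height_coordIdeal (K := K) (Finset.univ : Finset σ)
  rw [hfin.cast_ncard_eq] at h1
  rw [Finset.coe_univ, Finset.card_univ] at h2
  exact absurd (h2.trans h1) (not_le.2 hcard)

end Height

section Cubic

variable {k}

/-- The symmetric trilinear form `T` with `T(x, x, x) = 6 f(x)`, where `f` is the cubic with
coefficients `w`. -/
def polar (w : Fin 10 → k) (x y z : Fin 3 → k) : k :=
  6 * w 0 * (x 0 * y 0 * z 0) + 6 * w 1 * (x 1 * y 1 * z 1) + 6 * w 2 * (x 2 * y 2 * z 2) +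
  2 * w 3 * (x 0 * y 0 * z 1 + x 0 * y 1 * z 0 + x 1 * y 0 * z 0) +
  2 * w 4 * (x 0 * y 0 * z 2 + x 0 * y 2 * z 0 + x 2 * y 0 * z 0) +
  2 * w 5 * (x 1 * y 1 * z 0 + x 1 * y 0 * z 1 + x 0 * y 1 * z 1) +
  2 * w 6 * (x 1 * y 1 * z 2 + x 1 * y 2 * z 1 + x 2 * y 1 * z 1) +
  2 * w 7 * (x 2 * y 2 * z 0 + x 2 * y 0 * z 2 + x 0 * y 2 * z 2) +
  2 * w 8 * (x 2 * y 2 * z 1 + x 2 * y 1 * z 2 + x 1 * y 2 * z 2) +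
  w 9 * (x 0 * y 1 * z 2 + x 0 * y 2 * z 1 + x 1 * y 0 * z 2 + x 1 * y 2 * z 0 +
    x 2 * y 0 * z 1 + x 2 * y 1 * z 0)

/-- The Hessian matrix at `x` of the cubic with coefficients `w`. -/
def hessian (w : Fin 10 → k) (x : Fin 3 → k) : Matrix (Fin 3) (Fin 3) k :=
  Matrix.of fun i j => polar w x (Pi.single i 1) (Pi.single j 1)

/-- The coefficients of `f ∘ N`, where `f` is the cubic with coefficients `w`. -/
def cubicComp (w : Fin 10 → k) (N : Matrix (Fin 3) (Fin 3) k) : Fin 10 → k :=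
  ![6⁻¹ * polar w (N.col 0) (N.col 0) (N.col 0), 6⁻¹ * polar w (N.col 1) (N.col 1) (N.col 1),
    6⁻¹ * polar w (N.col 2) (N.col 2) (N.col 2), 2⁻¹ * polar w (N.col 0) (N.col 0) (N.col 1),
    2⁻¹ * polar w (N.col 0) (N.col 0) (N.col 2), 2⁻¹ * polar w (N.col 1) (N.col 1) (N.col 0),
    2⁻¹ * polar w (N.col 1) (N.col 1) (N.col 2), 2⁻¹ * polar w (N.col 2) (N.col 2) (N.col 0),
    2⁻¹ * polar w (N.col 2) (N.col 2) (N.col 1), polar w (N.col 0) (N.col 1) (N.col 2)]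

lemma eval_fpoly_s12 (x : Fin 3 ⊕ Fin 10 → k) [CharZero k] :
    eval x (fpoly k) = 6⁻¹ * polar (x ∘ Sum.inr) (x ∘ Sum.inl) (x ∘ Sum.inl) (x ∘ Sum.inl) := by
  simp [fpoly, polar, Fin.sum_univ_succ, Fin.prod_univ_three, cubicExp]
  ring

lemma eval_hpoly_s12 (x : Fin 3 ⊕ Fin 10 → k) :
    eval x (hpoly k) = (hessian (x ∘ Sum.inr) (x ∘ Sum.inl)).det := by
  have hnum (i : Fin 3 ⊕ Fin 10) (n : ℕ) [n.AtLeastTwo] :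
      pderiv i (OfNat.ofNat n : MvPolynomial (Fin 3 ⊕ Fin 10) k) = 0 :=
    (pderiv i).map_natCast n
  rw [hpoly, RingHom.map_det]
  congr 1
  ext i j
  fin_cases i <;> fin_cases j <;>
  · simp [hessian, fpoly, polar, Fin.sum_univ_succ, Fin.prod_univ_three, cubicExp, pderiv_X,
      hnum, Pi.single_apply]
    try ring

lemma mem_flexCone_iff [CharZero k] {x : Fin 3 ⊕ Fin 10 → k} :
    x ∈ flexCone k ↔
      polar (x ∘ Sum.inr) (x ∘ Sum.inl) (x ∘ Sum.inl) (x ∘ Sum.inl) = 0 ∧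
      (hessian (x ∘ Sum.inr) (x ∘ Sum.inl)).det = 0 := by
  rw [flexCone, Set.mem_ofPred_eq, eval_fpoly_s12, eval_hpoly_s12]
  simp

lemma polar_cubicComp [CharZero k] (w : Fin 10 → k) (N : Matrix (Fin 3) (Fin 3) k)
    (x y z : Fin 3 → k) :
    polar (cubicComp w N) x y z = polar w (N.mulVec x) (N.mulVec y) (N.mulVec z) := by
  simp [polar, cubicComp, Matrix.mulVec, dotProduct, Fin.sum_univ_three]
  ring

lemma polar_injective [CharZero k] {w w' : Fin 10 → k}
    (h : ∀ x y z, polar w x y z = polar w' x y z) : w = w' := by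
  have H (a b c : Fin 3) := h (Pi.single a 1) (Pi.single b 1) (Pi.single c 1)
  ext j
  fin_cases j
  · simpa [polar] using H 0 0 0
  · simpa [polar] using H 1 1 1
  · simpa [polar] using H 2 2 2
  · simpa [polar] using H 0 0 1
  · simpa [polar] using H 0 0 2
  · simpa [polar] using H 1 1 0
  · simpa [polar] using H 1 1 2
  · simpa [polar] using H 2 2 0
  · simpa [polar] using H 2 2 1
  · simpa [polar] using H 0 1 2

lemma cubicComp_cubicComp [CharZero k] (w : Fin 10 → k) (M N : Matrix (Fin 3) (Fin 3) k) :
    cubicComp (cubicComp w M) N = cubicComp w (M * N) :=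
  polar_injective fun x y z => by simp [polar_cubicComp]

lemma cubicComp_one [CharZero k] (w : Fin 10 → k) : cubicComp w 1 = w :=
  polar_injective fun x y z => by simp [polar_cubicComp]

lemma hessian_cubicComp [CharZero k] (w : Fin 10 → k) (N : Matrix (Fin 3) (Fin 3) k)
    (x : Fin 3 → k) :
    hessian (cubicComp w N) x = N.transpose * hessian w (N.mulVec x) * N := by
  ext i j
  rw [hessian, Matrix.of_apply, polar_cubicComp, Matrix.mulVec_single_one, Matrix.mulVec_single_one]
  generalize N.mulVec x = u
  simp [Matrix.mul_apply, hessian, Fin.sum_univ_three, polar]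
  ring

lemma polar_smul (w : Fin 10 → k) (c : k) (x : Fin 3 → k) :
    polar w (c • x) (c • x) (c • x) = c ^ 3 * polar w x x x := by
  simp [polar]
  ring

lemma hessian_smul (w : Fin 10 → k) (c : k) (x : Fin 3 → k) :
    hessian w (c • x) = c • hessian w x := by
  ext i j
  simp [polar, hessian]
  ring

lemma polar_single_zero (w : Fin 10 → k) :
    polar w (Pi.single 0 1) (Pi.single 0 1) (Pi.single 0 1) = 6 * w 0 := by
  simp [polar]

lemma hessian_single_zero (w : Fin 10 → k) :
    hessian w (Pi.single 0 1) =
      !![6 * w 0, 2 * w 3, 2 * w 4; 2 * w 3, 2 * w 5, w 9; 2 * w 4, w 9, 2 * w 7] := by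
  ext i j
  fin_cases i <;> fin_cases j <;> simp [polar, hessian]

lemma exists_binary_form_zero [IsAlgClosed k] [CharZero k] (d e f : k) :
    ∃ p q : k, (p ≠ 0 ∨ q ≠ 0) ∧ d * p ^ 2 + e * p * q + f * q ^ 2 = 0 := by
  by_cases hd : d = 0
  · exact ⟨1, 0, by simp, by simp [hd]⟩
  · obtain ⟨s, hs⟩ := IsAlgClosed.exists_eq_mul_self (discrim d e f)
    obtain ⟨p, hp⟩ := exists_quadratic_eq_zero hd ⟨s, hs⟩
    exact ⟨p, 1, by simp, by linear_combination hp⟩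

lemma exists_isUnit_det_col_zero {v : Fin 3 → k} (hv : v ≠ 0) :
    ∃ M : Matrix (Fin 3) (Fin 3) k, IsUnit M.det ∧ M.col 0 = v := by
  obtain ⟨i, hi⟩ := Function.ne_iff.1 hv
  simp only [isUnit_iff_ne_zero]
  fin_cases i
  · refine ⟨!![v 0, 0, 0; v 1, 1, 0; v 2, 0, 1], ?_, ?_⟩
    · simpa [Matrix.det_fin_three] using hi
    · ext i; fin_cases i <;> rfl
  · refine ⟨!![v 0, 1, 0; v 1, 0, 0; v 2, 0, 1], ?_, ?_⟩
    · simpa [Matrix.det_fin_three] using hi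
    · ext i; fin_cases i <;> rfl
  · refine ⟨!![v 0, 1, 0; v 1, 0, 1; v 2, 0, 0], ?_, ?_⟩
    · simpa [Matrix.det_fin_three] using hi
    · ext i; fin_cases i <;> rfl

/-- A cubic with a flex at `(1 : 0 : 0)` can be brought to a form with flex tangent `x₁ = 0` by a
linear change of coordinates fixing that point. -/
lemma exists_normal_form_of_single [IsAlgClosed k] [CharZero k] {w : Fin 10 → k} (h0 : w 0 = 0)
    (hdet : (hessian w (Pi.single 0 1)).det = 0) :
    ∃ M : Matrix (Fin 3) (Fin 3) k, IsUnit M.det ∧ M.col 0 = Pi.single 0 1 ∧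
      cubicComp w M 0 = 0 ∧ cubicComp w M 4 = 0 ∧ cubicComp w M 7 = 0 := by
  obtain ⟨p, q, hpq, h1, h2⟩ : ∃ p q : k, (p ≠ 0 ∨ q ≠ 0) ∧ w 3 * p + w 4 * q = 0 ∧
      w 5 * p ^ 2 + w 9 * p * q + w 7 * q ^ 2 = 0 := by
    by_cases hbc : w 3 = 0 ∧ w 4 = 0
    · obtain ⟨p, q, hpq, h⟩ := exists_binary_form_zero (w 5) (w 9) (w 7)
      exact ⟨p, q, hpq, by simp [hbc], h⟩
    · refine ⟨w 4, -w 3, ?_, by ring, ?_⟩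
      · rw [neg_ne_zero]; tauto
      · rw [hessian_single_zero, Matrix.det_fin_three] at hdet
        simp [h0] at hdet
        linear_combination (-8⁻¹ : k) * hdet
  obtain ⟨r, s, hrs⟩ : ∃ r s : k, r * q - s * p ≠ 0 := by
    rcases hpq with hp | hq
    · exact ⟨0, 1, by simpa using hp⟩
    · exact ⟨1, 0, by simpa using hq⟩
  refine ⟨!![1, 0, 0; 0, r, p; 0, s, q], ?_, ?_, ?_, ?_, ?_⟩
  · rw [isUnit_iff_ne_zero]
    convert hrs using 1
    simp [Matrix.det_fin_three]
    ring
  · ext i; fin_cases i <;> simp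
  · simp [cubicComp, polar, h0]
  · simp [cubicComp, polar, h0]
    linear_combination 2 * h1
  · simp [cubicComp, polar, h0]
    linear_combination 2 * h2

lemma exists_normal_form [IsAlgClosed k] [CharZero k] {w : Fin 10 → k} {v : Fin 3 → k}
    (hv : v ≠ 0) (hf : polar w v v v = 0) (hh : (hessian w v).det = 0) :
    ∃ M : Matrix (Fin 3) (Fin 3) k, IsUnit M.det ∧ M.col 0 = v ∧
      cubicComp w M 0 = 0 ∧ cubicComp w M 4 = 0 ∧ cubicComp w M 7 = 0 := by
  obtain ⟨B, hB, hBv⟩ := exists_isUnit_det_col_zero hv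
  have hBv' : B.mulVec (Pi.single 0 1) = v := by rw [Matrix.mulVec_single_one, hBv]
  have h0 : cubicComp w B 0 = 0 := by simp [cubicComp, hBv, hf]
  have hdet : (hessian (cubicComp w B) (Pi.single 0 1)).det = 0 := by
    simp [hessian_cubicComp, hBv', hh]
  obtain ⟨M, hM, hM0, h⟩ := exists_normal_form_of_single h0 hdet
  refine ⟨B * M, by rw [Matrix.det_mul]; exact hB.mul hM, ?_, by rwa [← cubicComp_cubicComp]⟩
  rw [← Matrix.mulVec_single_one, ← Matrix.mulVec_mulVec, Matrix.mulVec_single_one, hM0, hBv']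

/-- Coefficients of a general cubic with a flex at `(1 : 0 : 0)` and flex tangent `x₁ = 0`. -/
def flexNormalForm (c : Fin 7 → k) : Fin 10 → k :=
  ![0, c 0, c 1, c 2, 0, c 3, c 4, 0, c 5, c 6]

/-- A parametrization of the flex cone by a scalar, a matrix, and a cubic in normal form. -/
def flexParam (a : Unit ⊕ (Fin 3 × Fin 3) ⊕ Fin 7 → k) : Fin 3 ⊕ Fin 10 → k :=
  let N : Matrix (Fin 3) (Fin 3) k := Matrix.of fun i j => a (.inr (.inl (i, j)))
  Sum.elim (a (.inl ()) • N.adjugate.col 0)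
    (cubicComp (flexNormalForm fun i => a (.inr (.inr i))) N)

lemma flexParam_elim (s : k) (N : Matrix (Fin 3) (Fin 3) k) (c : Fin 7 → k) :
    flexParam (Sum.elim (fun _ => s) (Sum.elim (fun ij => N ij.1 ij.2) c)) =
      Sum.elim (s • N.adjugate.col 0) (cubicComp (flexNormalForm c) N) :=
  rfl

lemma flexParam_mem [CharZero k] (a : Unit ⊕ (Fin 3 × Fin 3) ⊕ Fin 7 → k) :
    flexParam a ∈ flexCone k := by
  rw [mem_flexCone_iff]
  simp only [flexParam, Sum.elim_comp_inl, Sum.elim_comp_inr]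
  generalize (Matrix.of fun i j => a (.inr (.inl (i, j))) : Matrix (Fin 3) (Fin 3) k) = N
  generalize a (.inl ()) = s
  have hN : N.mulVec (s • N.adjugate.col 0) = (s * N.det) • Pi.single 0 1 := by
    rw [Matrix.mulVec_smul, ← Matrix.mulVec_single_one, Matrix.mulVec_mulVec, Matrix.mul_adjugate,
      Matrix.smul_mulVec, Matrix.one_mulVec, smul_smul]
  rw [polar_cubicComp, hessian_cubicComp, hN, polar_smul, polar_single_zero, hessian_smul,
    hessian_single_zero]
  simp [flexNormalForm, Matrix.det_fin_three]

lemma exists_flex [IsAlgClosed k] [CharZero k] (w : Fin 10 → k) :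
    ∃ v : Fin 3 → k, v ≠ 0 ∧ polar w v v v = 0 ∧ (hessian w v).det = 0 := by
  let φ := aeval (R := k) (Sum.elim X fun j => C (w j) :
    Fin 3 ⊕ Fin 10 → MvPolynomial (Fin 3) k)
  have hφ (p) (v : Fin 3 → k) : eval v (φ p) = eval (Sum.elim v w) p := by
    simp only [φ, ← aeval_eq_eval, ← AlgHom.comp_apply]
    congr 1
    ext i
    rcases i with i | i <;> simp
  obtain ⟨v, hv, h⟩ := exists_ne_zero_common_zero {φ (fpoly k), φ (hpoly k)}
    (by
      rintro p (rfl | rfl)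
      · rw [hφ, eval_fpoly_s12]
        simp [polar]
      · rw [hφ, eval_hpoly_s12]
        simp [hessian, polar, Matrix.det_fin_three])
    (lt_of_le_of_lt (Set.encard_insert_le _ _) (by
      rw [Set.encard_singleton, Fintype.card_fin]
      norm_num))
  have hmem : Sum.elim v w ∈ flexCone k :=
    ⟨by rw [← hφ]; exact h _ (by simp), by rw [← hφ]; exact h _ (by simp)⟩
  exact ⟨v, hv, by simpa using mem_flexCone_iff.1 hmem⟩

lemma flexNormalForm_eq {g : Fin 10 → k} (h0 : g 0 = 0) (h4 : g 4 = 0) (h7 : g 7 = 0) :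
    flexNormalForm ![g 1, g 2, g 3, g 5, g 6, g 8, g 9] = g := by
  ext j
  fin_cases j <;> simp [flexNormalForm, h0, h4, h7]

lemma det_smul_adjugate_inv {M : Matrix (Fin 3) (Fin 3) k} (hM : IsUnit M.det) :
    M.det • M⁻¹.adjugate = M := by
  have hMN : M * M⁻¹ = 1 := Matrix.mul_nonsing_inv M hM
  have hadj : M⁻¹.adjugate = M⁻¹.det • M := by
    rw [← mul_one M⁻¹.adjugate, ← Matrix.nonsing_inv_mul M hM, ← mul_assoc, Matrix.adjugate_mul,
      smul_mul_assoc, one_mul]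
  rw [hadj, smul_smul, ← Matrix.det_mul, hMN, Matrix.det_one, one_smul]

lemma exists_flexParam_eq [IsAlgClosed k] [CharZero k] {w : Fin 10 → k} {v : Fin 3 → k}
    (hv : v ≠ 0) (hf : polar w v v v = 0) (hh : (hessian w v).det = 0) (c : k) :
    ∃ a, flexParam a = Sum.elim (c • v) w := by
  obtain ⟨M, hM, hMv, h0, h4, h7⟩ := exists_normal_form hv hf hh
  have hcol : M.det • M⁻¹.adjugate.col 0 = v := by
    rw [← hMv, ← Matrix.mulVec_single_one, ← Matrix.smul_mulVec, det_smul_adjugate_inv hM,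
      Matrix.mulVec_single_one]
  generalize hg : cubicComp w M = g at h0 h4 h7
  refine ⟨Sum.elim (fun _ => c * M.det) (Sum.elim (fun ij => M⁻¹ ij.1 ij.2)
    ![g 1, g 2, g 3, g 5, g 6, g 8, g 9]), ?_⟩
  rw [flexParam_elim, flexNormalForm_eq h0 h4 h7, mul_smul, hcol, ← hg, cubicComp_cubicComp,
    Matrix.mul_nonsing_inv M hM, cubicComp_one]

lemma range_flexParam [IsAlgClosed k] [CharZero k] :
    Set.range (flexParam (k := k)) = flexCone k := by
  refine Set.Subset.antisymm (Set.range_subset_iff.2 flexParam_mem) fun x hx => ?_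
  obtain ⟨v, w, rfl⟩ : ∃ v w, x = Sum.elim v w := ⟨_, _, (Sum.elim_comp_inl_inr x).symm⟩
  rw [mem_flexCone_iff, Sum.elim_comp_inl, Sum.elim_comp_inr] at hx
  by_cases hv : v = 0
  · obtain ⟨v', hv', hf, hh⟩ := exists_flex w
    simpa [hv] using exists_flexParam_eq hv' hf hh 0
  · simpa using exists_flexParam_eq hv hx.1 hx.2 1

lemma IsPolyFun.polar {σ : Type*} {w : (σ → k) → Fin 10 → k} {x y z : (σ → k) → Fin 3 → k}
    (hw : ∀ i, IsPolyFun fun a => w a i) (hx : ∀ i, IsPolyFun fun a => x a i)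
    (hy : ∀ i, IsPolyFun fun a => y a i) (hz : ∀ i, IsPolyFun fun a => z a i) :
    IsPolyFun fun a => polar (w a) (x a) (y a) (z a) := by
  unfold _root_.polar
  repeat' first
    | exact hw _
    | exact hx _
    | exact hy _
    | exact hz _
    | exact IsPolyFun.const _
    | apply IsPolyFun.add
    | apply IsPolyFun.mul

lemma continuous_flexParam : Continuous (flexParam (k := k)) := by
  have hN (i j : Fin 3) : IsPolyFun fun a : Unit ⊕ (Fin 3 × Fin 3) ⊕ Fin 7 → k =>
      a (.inr (.inl (i, j))) := .coord _
  have hw (i : Fin 10) : IsPolyFun fun a : Unit ⊕ (Fin 3 × Fin 3) ⊕ Fin 7 → k =>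
      flexNormalForm (fun i => a (.inr (.inr i))) i := by
    fin_cases i <;> first | exact .coord _ | exact .const 0
  refine continuous_of_isPolyFun ?_
  rintro (i | j)
  · refine IsPolyFun.mul (.coord _) ?_
    simp only [Matrix.adjugate_fin_three]
    fin_cases i
    · exact ((hN _ _).mul (hN _ _)).sub ((hN _ _).mul (hN _ _))
    · exact ((hN _ _).mul (hN _ _)).neg.add ((hN _ _).mul (hN _ _))
    · exact ((hN _ _).mul (hN _ _)).sub ((hN _ _).mul (hN _ _))
  · have hp (a b c : Fin 3) := IsPolyFun.polar hw (fun i => hN i a) (fun i => hN i b)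
      (fun i => hN i c)
    fin_cases j
    iterate 9 exact (IsPolyFun.const _).mul (hp _ _ _)
    exact hp _ _ _

end Cubic

/-- **Proposition.** The affine multi-cone `C = {f = h = 0} ⊆ L × Φ` over the variety of
flexes of plane cubics is an irreducible closed subset of the 13-dimensional affine
space `L × Φ`. -/
theorem flexCone_isClosed_isIrreducible [IsAlgClosed k] [CharZero k] :
    IsClosed (flexCone k) ∧ IsIrreducible (flexCone k) := by
  refine ⟨(isClosed_zeros _).inter (isClosed_zeros _), ?_⟩
  rw [← range_flexParam, ← Set.image_univ]
  exact isIrreducible_affineSpace.image _ continuous_flexParam.continuousOn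

end
end
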